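/- arXiv:1405.7886 — 2 statements merged into one kernel-verified Lean document; each statement's English description precedes it below -/
import Mathlib

section
/- Every 5-dimensional linear subspace W of ℝ⁸ contains exactly one Cayley subspace: there exists a unique 4-dimensional subspace V ⊆ W admitting an orthonormal basis (v₁,v₂,v₃,v₄) with Φ₀(v₁,v₂,v₃,v₄) = 1. -/
open scoped RealInnerProductSpace

noncomputable section

abbrev E8 := EuclideanSpace ℝ (Fin 8)

/-- The 4-form `dx_{ijkl}` on `ℝ⁸`. -/
def dx4 (i j k l : Fin 8) (v : Fin 4 → E8) : ℝ :=
  Matrix.det (Matrix.of fun r s : Fin 4 => v s (![i, j, k, l] r))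

/-- The Cayley 4-form `Φ₀` on `ℝ⁸`. -/
def Phi0 (v : Fin 4 → E8) : ℝ :=
  dx4 0 1 2 3 v + dx4 0 1 4 5 v - dx4 0 1 6 7 v + dx4 0 2 4 6 v + dx4 0 2 5 7 v
    + dx4 0 3 4 7 v - dx4 0 3 5 6 v - dx4 1 2 4 7 v + dx4 1 2 5 6 v + dx4 1 3 4 6 v
    + dx4 1 3 5 7 v - dx4 2 3 4 5 v + dx4 2 3 6 7 v + dx4 4 5 6 7 v

/-- The Cayley form applied to four vectors. -/
def Phi (a b c d : E8) : ℝ := Phi0 ![a, b, c, d]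

/-- The `i`-th standard basis vector of `ℝ⁸`. -/
def stdB (i : Fin 8) : E8 := EuclideanSpace.single i 1

/-- The triple cross product: the unique vector with `⟪x, u×v×w⟫ = Φ₀(x,u,v,w)`
for all `x`. -/
def crossTriple (u v w : E8) : E8 :=
  (EuclideanSpace.equiv (Fin 8) ℝ).symm fun i => Phi (stdB i) u v w

/-- A 4-dimensional subspace of `ℝ⁸` is Cayley if it has an orthonormal basis on which
`Φ₀` takes the value `1`. -/
def IsCayley (V : Submodule ℝ E8) : Prop :=
  Module.finrank ℝ V = 4 ∧
    ∃ v : Fin 4 → E8, (∀ i, v i ∈ V) ∧ Orthonormal ℝ v ∧ Phi0 v = 1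

/-- The `3 × 3` minor of `u, v, w` on the coordinates `j, k, l`. -/
def minor3 (j k l : Fin 8) (u v w : E8) : ℝ :=
  u j * (v k * w l - v l * w k) - u k * (v j * w l - v l * w j) + u l * (v j * w k - v k * w j)

theorem dx4_eq_minor3 (i j k l : Fin 8) (a b c d : E8) :
    dx4 i j k l ![a, b, c, d] = a i * minor3 j k l b c d - a j * minor3 i k l b c d
      + a k * minor3 i j l b c d - a l * minor3 i j k b c d := by
  simp [dx4, minor3, Matrix.det_succ_row_zero, Fin.sum_univ_succ, Fin.succAbove]
  ring

theorem stdB_apply (i j : Fin 8) : stdB i j = if j = i then 1 else 0 := by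
  simp [stdB]

theorem crossTriple_apply (u v w : E8) (i : Fin 8) : crossTriple u v w i = Phi (stdB i) u v w :=
  rfl

theorem crossTriple_apply_0 (u v w : E8) : crossTriple u v w 0 =
    minor3 1 2 3 u v w + minor3 1 4 5 u v w - minor3 1 6 7 u v w + minor3 2 4 6 u v w
        + minor3 2 5 7 u v w + minor3 3 4 7 u v w - minor3 3 5 6 u v w := by
  simp [crossTriple_apply, Phi, Phi0, dx4_eq_minor3, stdB_apply]

theorem crossTriple_apply_1 (u v w : E8) : crossTriple u v w 1 =
    -minor3 0 2 3 u v w - minor3 0 4 5 u v w + minor3 0 6 7 u v w - minor3 2 4 7 u v w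
        + minor3 2 5 6 u v w + minor3 3 4 6 u v w + minor3 3 5 7 u v w := by
  simp [crossTriple_apply, Phi, Phi0, dx4_eq_minor3, stdB_apply]
  ring

theorem crossTriple_apply_2 (u v w : E8) : crossTriple u v w 2 =
    minor3 0 1 3 u v w - minor3 0 4 6 u v w - minor3 0 5 7 u v w + minor3 1 4 7 u v w
        - minor3 1 5 6 u v w - minor3 3 4 5 u v w + minor3 3 6 7 u v w := by
  simp [crossTriple_apply, Phi, Phi0, dx4_eq_minor3, stdB_apply]
  ring

theorem crossTriple_apply_3 (u v w : E8) : crossTriple u v w 3 =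
    -minor3 0 1 2 u v w - minor3 0 4 7 u v w + minor3 0 5 6 u v w - minor3 1 4 6 u v w
        - minor3 1 5 7 u v w + minor3 2 4 5 u v w - minor3 2 6 7 u v w := by
  simp [crossTriple_apply, Phi, Phi0, dx4_eq_minor3, stdB_apply]
  ring

theorem crossTriple_apply_4 (u v w : E8) : crossTriple u v w 4 =
    minor3 0 1 5 u v w + minor3 0 2 6 u v w + minor3 0 3 7 u v w - minor3 1 2 7 u v w
        + minor3 1 3 6 u v w - minor3 2 3 5 u v w + minor3 5 6 7 u v w := by
  simp [crossTriple_apply, Phi, Phi0, dx4_eq_minor3, stdB_apply]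

theorem crossTriple_apply_5 (u v w : E8) : crossTriple u v w 5 =
    -minor3 0 1 4 u v w + minor3 0 2 7 u v w - minor3 0 3 6 u v w + minor3 1 2 6 u v w
        + minor3 1 3 7 u v w + minor3 2 3 4 u v w - minor3 4 6 7 u v w := by
  simp [crossTriple_apply, Phi, Phi0, dx4_eq_minor3, stdB_apply]
  ring

theorem crossTriple_apply_6 (u v w : E8) : crossTriple u v w 6 =
    -minor3 0 1 7 u v w - minor3 0 2 4 u v w + minor3 0 3 5 u v w - minor3 1 2 5 u v w
        - minor3 1 3 4 u v w + minor3 2 3 7 u v w + minor3 4 5 7 u v w := by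
  simp [crossTriple_apply, Phi, Phi0, dx4_eq_minor3, stdB_apply]
  ring

theorem crossTriple_apply_7 (u v w : E8) : crossTriple u v w 7 =
    minor3 0 1 6 u v w - minor3 0 2 5 u v w - minor3 0 3 4 u v w + minor3 1 2 4 u v w
        - minor3 1 3 5 u v w - minor3 2 3 6 u v w - minor3 4 5 6 u v w := by
  simp [crossTriple_apply, Phi, Phi0, dx4_eq_minor3, stdB_apply]
  ring

theorem Phi_eq_sum (a b c d : E8) : Phi a b c d = ∑ i, a i * crossTriple b c d i := by
  simp only [Fin.sum_univ_eight, crossTriple_apply_0, crossTriple_apply_1, crossTriple_apply_2,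
    crossTriple_apply_3, crossTriple_apply_4, crossTriple_apply_5, crossTriple_apply_6,
    crossTriple_apply_7, Phi, Phi0, dx4_eq_minor3]
  ring

theorem inner_eq_sum (x y : E8) : ⟪x, y⟫ = ∑ i, x i * y i := by
  simp [PiLp.inner_apply, mul_comm]

theorem Phi_eq_inner (a b c d : E8) : Phi a b c d = ⟪a, crossTriple b c d⟫ := by
  rw [Phi_eq_sum, inner_eq_sum]

set_option maxHeartbeats 4000000 in
/-- The double triple cross product, an identity of quintic polynomials in the coordinates. -/
theorem crossTriple_crossTriple (e a b c : E8) :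
    crossTriple (crossTriple e a b) e c =
      -(⟪e, e⟫ • crossTriple a b c) + ⟪e, a⟫ • crossTriple e b c + ⟪e, b⟫ • crossTriple a e c
        + ⟪e, c⟫ • crossTriple a b e - Phi a b c e • e
        - (⟪a, e⟫ * ⟪b, c⟫ - ⟪a, c⟫ * ⟪b, e⟫) • e + (⟪e, e⟫ * ⟪b, c⟫ - ⟪e, c⟫ * ⟪b, e⟫) • a
        - (⟪e, e⟫ * ⟪a, c⟫ - ⟪e, c⟫ * ⟪a, e⟫) • b := by
  simp only [inner_eq_sum, Phi_eq_sum]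
  ext i
  fin_cases i <;>
  · simp [Fin.sum_univ_eight, crossTriple_apply_0, crossTriple_apply_1, crossTriple_apply_2,
      crossTriple_apply_3, crossTriple_apply_4, crossTriple_apply_5, crossTriple_apply_6,
      crossTriple_apply_7, minor3]
    ring

theorem crossTriple_swap_left (u v w : E8) : crossTriple v u w = -crossTriple u v w := by
  ext i
  fin_cases i <;>
  · simp [crossTriple_apply_0, crossTriple_apply_1, crossTriple_apply_2, crossTriple_apply_3,
      crossTriple_apply_4, crossTriple_apply_5, crossTriple_apply_6, crossTriple_apply_7, minor3]
    ring

theorem crossTriple_swap_right (u v w : E8) : crossTriple u w v = -crossTriple u v w := by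
  ext i
  fin_cases i <;>
  · simp [crossTriple_apply_0, crossTriple_apply_1, crossTriple_apply_2, crossTriple_apply_3,
      crossTriple_apply_4, crossTriple_apply_5, crossTriple_apply_6, crossTriple_apply_7, minor3]
    ring

theorem Phi_swap_left (a b c d : E8) : Phi b a c d = -Phi a b c d := by
  simp only [Phi, Phi0, dx4_eq_minor3, minor3]
  ring

theorem Phi_swap_middle (a b c d : E8) : Phi a c b d = -Phi a b c d := by
  rw [Phi_eq_inner, Phi_eq_inner, crossTriple_swap_left, inner_neg_right]

theorem Phi_swap_right (a b c d : E8) : Phi a b d c = -Phi a b c d := by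
  rw [Phi_eq_inner, Phi_eq_inner, crossTriple_swap_right, inner_neg_right]

theorem Phi_self_left (a c d : E8) : Phi a a c d = 0 := by
  linarith [Phi_swap_left a a c d]

theorem Phi_self_middle (a b d : E8) : Phi a b b d = 0 := by
  linarith [Phi_swap_middle a b b d]

theorem Phi_self_right (a b c : E8) : Phi a b c c = 0 := by
  linarith [Phi_swap_right a b c c]

theorem Phi_self_outer (a b c : E8) : Phi a b c b = 0 := by
  rw [Phi_swap_right, Phi_self_middle, neg_zero]

theorem Phi_rotate (a b c d : E8) : Phi b c d a = -Phi a b c d := by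
  rw [Phi_swap_right, Phi_swap_middle, Phi_swap_left, neg_neg]

theorem Phi_sum_left {ι : Type*} [Fintype ι] (r : ι → ℝ) (x : ι → E8) (b c d : E8) :
    Phi (∑ m, r m • x m) b c d = ∑ m, r m * Phi (x m) b c d := by
  simp [Phi_eq_inner, sum_inner, real_inner_smul_left]

theorem crossTriple_self_left (u w : E8) : crossTriple u u w = 0 := by
  rw [← inner_self_eq_zero (𝕜 := ℝ), ← Phi_eq_inner, Phi_self_middle]

theorem inner_crossTriple_crossTriple (e a b c d : E8) :
    ⟪crossTriple e a b, crossTriple e c d⟫ = -⟪d, crossTriple (crossTriple e a b) e c⟫ := by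
  rw [← Phi_eq_inner, ← Phi_eq_inner, ← Phi_rotate]

theorem inner_crossTriple_of_orthonormal_pair {e a b : E8} (he : ⟪e, e⟫ = 1) (ha : ⟪a, a⟫ = 1)
    (hea : ⟪e, a⟫ = 0) (heb : ⟪e, b⟫ = 0) (hab : ⟪a, b⟫ = 0) (d : E8) :
    ⟪crossTriple e a b, crossTriple e a d⟫ = ⟪d, b⟫ := by
  have h₁ : ⟪a, e⟫ = 0 := by rw [real_inner_comm, hea]
  have h₂ : ⟪b, e⟫ = 0 := by rw [real_inner_comm, heb]
  have h₃ : ⟪b, a⟫ = 0 := by rw [real_inner_comm, hab]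
  have h₄ : crossTriple a b a = 0 := by
    rw [crossTriple_swap_right, crossTriple_self_left, neg_zero]
  have h₅ : Phi a b a e = 0 := by rw [Phi_swap_middle, Phi_self_left, neg_zero]
  rw [inner_crossTriple_crossTriple, crossTriple_crossTriple]
  simp [-inner_self_eq_norm_sq_to_K, he, ha, hea, heb, h₁, h₂,
    h₃, h₄, h₅]

theorem inner_crossTriple_of_orthogonal {e a b c d : E8} (he : ⟪e, e⟫ = 1)
    (hea : ⟪e, a⟫ = 0) (heb : ⟪e, b⟫ = 0) (hec : ⟪e, c⟫ = 0) (hac : ⟪a, c⟫ = 0)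
    (hbc : ⟪b, c⟫ = 0) (hde : ⟪d, e⟫ = 0) :
    ⟪crossTriple e a b, crossTriple e c d⟫ = Phi d a b c := by
  have h₁ : ⟪a, e⟫ = 0 := by rw [real_inner_comm, hea]
  have h₂ : ⟪b, e⟫ = 0 := by rw [real_inner_comm, heb]
  rw [inner_crossTriple_crossTriple, crossTriple_crossTriple, Phi_eq_inner d]
  simp [-inner_self_eq_norm_sq_to_K, inner_sub_right,
    real_inner_smul_right, he, hea, heb, hec, hac, hbc, hde, h₁, h₂]

theorem crossTriple_eq_smul_of_sq_eq_one {a b c d : E8} (ha : ⟪a, a⟫ = 1) (hb : ⟪b, b⟫ = 1)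
    (hc : ⟪c, c⟫ = 1) (hd : ⟪d, d⟫ = 1) (hbc : ⟪b, c⟫ = 0) (hbd : ⟪b, d⟫ = 0) (hcd : ⟪c, d⟫ = 0)
    (h : Phi a b c d ^ 2 = 1) : crossTriple b c d = Phi a b c d • a := by
  have ht : ⟪crossTriple b c d, crossTriple b c d⟫ = 1 := by
    rw [inner_crossTriple_of_orthonormal_pair hb hc hbc hbd hcd, hd]
  rw [← sub_eq_zero, ← inner_self_eq_zero (𝕜 := ℝ)]
  rw [inner_sub_left, inner_sub_right, inner_sub_right, ht, real_inner_smul_left,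
    real_inner_smul_right, real_inner_smul_right, real_inner_smul_left, ha,
    real_inner_comm, ← Phi_eq_inner]
  linarith

set_option maxHeartbeats 4000000 in
/-- An alternating `4`-form on a `5`-dimensional space, given by its values on a basis, is
annihilated by contraction with some nonzero vector. -/
theorem exists_contraction_eq_zero (g : Fin 5 → Fin 5 → Fin 5 → Fin 5 → ℝ)
    (h₁ : ∀ i j k l, g j i k l = -g i j k l) (h₂ : ∀ i j k l, g i k j l = -g i j k l)
    (h₃ : ∀ i j k l, g i j l k = -g i j k l) :
    ∃ r : Fin 5 → ℝ, r ≠ 0 ∧ ∀ i j k, ∑ m, r m * g m i j k = 0 := by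
  have s₁ : ∀ {i j} (k l), j < i → g i j k l = -g j i k l := fun k l _ => h₁ _ _ k l
  have s₂ : ∀ {j k} (i l), k < j → g i j k l = -g i k j l := fun i l _ => h₂ i _ _ l
  have s₃ : ∀ {k l} (i j), l < k → g i j k l = -g i j l k := fun i j _ => h₃ i j _ _
  have z₁ : ∀ i k l, g i i k l = 0 := fun i k l => by linarith [h₁ i i k l]
  have z₂ : ∀ i j l, g i j j l = 0 := fun i j l => by linarith [h₂ i j j l]
  have z₃ : ∀ i j k, g i j k k = 0 := fun i j k => by linarith [h₃ i j k k]
  let r : Fin 5 → ℝ := ![g 1 2 3 4, -g 0 2 3 4, g 0 1 3 4, -g 0 1 2 4, g 0 1 2 3]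
  have hr : ∀ i j k, ∑ m, r m * g m i j k = 0 := by
    intro i j k
    fin_cases i <;> fin_cases j <;> fin_cases k <;>
      simp [r, Fin.sum_univ_five, s₁, s₂, s₃, z₁, z₂, z₃] <;> ring
  by_cases h : r = 0
  · have e := fun m => congrFun h m
    have e₀ : g 1 2 3 4 = 0 := e 0
    have e₁ : g 0 2 3 4 = 0 := neg_eq_zero.mp (e 1)
    have e₂ : g 0 1 3 4 = 0 := e 2
    have e₃ : g 0 1 2 4 = 0 := neg_eq_zero.mp (e 3)
    have e₄ : g 0 1 2 3 = 0 := e 4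
    refine ⟨fun _ => 1, fun h => one_ne_zero (congrFun h 0), fun i j k => ?_⟩
    fin_cases i <;> fin_cases j <;> fin_cases k <;>
      simp [Fin.sum_univ_five, s₁, s₂, s₃, z₁, z₂, z₃, e₀, e₁, e₂, e₃, e₄]
  · exact ⟨r, h, hr⟩

theorem inner_eq_zero_of_mem_span {ι : Type*} {w : ι → E8} {t z : E8}
    (h : ∀ i, ⟪w i, t⟫ = 0) (hz : z ∈ Submodule.span ℝ (Set.range w)) : ⟪z, t⟫ = 0 := by
  induction hz using Submodule.span_induction with
  | mem x hx => obtain ⟨i, rfl⟩ := hx; exact h i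
  | zero => simp
  | add x y _ _ hx hy => rw [inner_add_left, hx, hy, add_zero]
  | smul s x _ hx => rw [real_inner_smul_left, hx, mul_zero]

theorem Phi_eq_zero_of_mem_span {ι : Type*} {w : ι → E8} {n x y z : E8}
    (h : ∀ i j k, Phi n (w i) (w j) (w k) = 0) (hx : x ∈ Submodule.span ℝ (Set.range w))
    (hy : y ∈ Submodule.span ℝ (Set.range w)) (hz : z ∈ Submodule.span ℝ (Set.range w)) :
    Phi n x y z = 0 := by
  have rot : ∀ a b c : E8, Phi n a b c = Phi a b n c := fun a b c => by
    rw [Phi_swap_middle a n b c, Phi_swap_left n a b c, neg_neg]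
  have rot' : ∀ a b c : E8, Phi n a b c = Phi n b c a := fun a b c => by
    rw [Phi_swap_middle, Phi_swap_right, neg_neg]
  have step₁ : ∀ j k, Phi n x (w j) (w k) = 0 := fun j k => by
    rw [rot, Phi_eq_inner]
    exact inner_eq_zero_of_mem_span (fun i => by rw [← Phi_eq_inner, ← rot, h]) hx
  have step₂ : ∀ k, Phi n x y (w k) = 0 := fun k => by
    rw [rot', rot, Phi_eq_inner]
    exact inner_eq_zero_of_mem_span
      (fun i => by rw [← Phi_eq_inner, ← rot, ← rot', step₁]) hy
  rw [rot', rot', rot, Phi_eq_inner]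
  exact inner_eq_zero_of_mem_span (fun i => by rw [← Phi_eq_inner, ← rot, ← rot', ← rot', step₂]) hz

theorem exists_unit_Phi_eq_zero {W : Submodule ℝ E8} (hW : Module.finrank ℝ W = 5) :
    ∃ n ∈ W, ⟪n, n⟫ = 1 ∧ ∀ x ∈ W, ∀ y ∈ W, ∀ z ∈ W, Phi n x y z = 0 := by
  let B := Module.finBasisOfFinrankEq ℝ W hW
  let w : Fin 5 → E8 := fun i => B i
  have hspan : Submodule.span ℝ (Set.range w) = W := by
    have : Set.range w = W.subtype '' Set.range B := by rw [← Set.range_comp]; rfl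
    rw [this, Submodule.span_image, B.span_eq, Submodule.map_top, Submodule.range_subtype]
  have hli : LinearIndependent ℝ w := B.linearIndependent.map' W.subtype W.ker_subtype
  obtain ⟨r, hr, hg⟩ := exists_contraction_eq_zero
    (fun i j k l => Phi (w i) (w j) (w k) (w l)) (fun _ _ _ _ => Phi_swap_left _ _ _ _)
    (fun _ _ _ _ => Phi_swap_middle _ _ _ _) (fun _ _ _ _ => Phi_swap_right _ _ _ _)
  let p : E8 := ∑ m, r m • w m
  have hp : p ≠ 0 := fun h => hr (funext (Fintype.linearIndependent_iff.mp hli r h))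
  have hpW : p ∈ W := W.sum_mem fun m _ => W.smul_mem _ (B m).2
  refine ⟨‖p‖⁻¹ • p, W.smul_mem _ hpW, ?_, fun x hx y hy z hz => ?_⟩
  · rw [real_inner_self_eq_norm_sq, norm_smul, norm_inv, norm_norm,
      inv_mul_cancel₀ (norm_ne_zero_iff.mpr hp), one_pow]
  · rw [Phi_eq_inner, real_inner_smul_left, ← Phi_eq_inner,
      Phi_eq_zero_of_mem_span (w := w) (fun i j k => by rw [Phi_sum_left]; exact hg i j k)
        (hspan ▸ hx) (hspan ▸ hy) (hspan ▸ hz), mul_zero]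

/-- A vector whose triple products with pairs from an orthogonal `4`-frame are orthogonal to the
frame forces the frame to be Cayley up to orientation. -/
theorem Phi_sq_eq_one {n d e a b : E8} (hn : ⟪n, n⟫ = 1) (hd : ⟪d, d⟫ = 1) (he : ⟪e, e⟫ = 1)
    (ha : ⟪a, a⟫ = 1) (hb : ⟪b, b⟫ = 1) (hnd : ⟪n, d⟫ = 0) (hne : ⟪n, e⟫ = 0) (hna : ⟪n, a⟫ = 0)
    (hnb : ⟪n, b⟫ = 0) (hde : ⟪d, e⟫ = 0) (hda : ⟪d, a⟫ = 0) (hdb : ⟪d, b⟫ = 0)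
    (hea : ⟪e, a⟫ = 0) (heb : ⟪e, b⟫ = 0) (hab : ⟪a, b⟫ = 0)
    (h₁ : Phi n e a b = 0) (h₂ : Phi n d e a = 0) (h₃ : Phi n d e b = 0) (h₄ : Phi n d a b = 0) :
    Phi d e a b ^ 2 = 1 := by
  have comm : ∀ {x y : E8}, ⟪x, y⟫ = 0 → ⟪y, x⟫ = 0 := fun h => by rw [real_inner_comm, h]
  have hT : ∀ {x : E8}, ⟪e, x⟫ = 0 → ⟪n, x⟫ = 0 → ∀ y,
      ⟪crossTriple e n x, crossTriple e n y⟫ = ⟪y, x⟫ := fun h h' y =>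
    inner_crossTriple_of_orthonormal_pair he hn (comm hne) h h' y
  have hq : ∀ {x y : E8}, Phi n x e y = 0 → ⟪x, crossTriple e n y⟫ = 0 := fun {x y} h => by
    rw [← Phi_eq_inner, Phi_swap_middle, Phi_swap_left, neg_neg, h]
  have hq' : ∀ {x y : E8}, Phi n x e y = 0 → ⟪crossTriple e n y, x⟫ = 0 := fun h => comm (hq h)
  let F : Fin 8 → E8 :=
    ![n, d, e, a, b, crossTriple e n d, crossTriple e n a, crossTriple e n b]
  have h₄' : Phi n a e b = 0 := by rw [Phi_swap_middle, h₁, neg_zero]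
  have h₅ : Phi n b e a = 0 := by rw [Phi_swap_middle, Phi_swap_right, h₁, neg_zero, neg_zero]
  have h₆ : Phi n a e d = 0 := by
    rw [Phi_swap_right, Phi_swap_middle, Phi_swap_right, h₂]; simp
  have h₇ : Phi n b e d = 0 := by
    rw [Phi_swap_right, Phi_swap_middle, Phi_swap_right, h₃]; simp
  have hF : Orthonormal ℝ F := by
    rw [orthonormal_iff_ite]
    intro i j
    fin_cases i <;> fin_cases j <;>
      simp [-inner_self_eq_norm_sq_to_K, F, hq, hq', hT, hn, hd, he, ha, hb, hnd, hne, hna, hnb,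
        hde, hda, hdb, hea, heb, hab, comm hnd, comm hne, comm hna, comm hnb, comm hde, comm hda,
        comm hdb, comm hea, comm heb, comm hab, h₂, h₃, h₄', h₅, h₆, h₇, Phi_self_left,
        Phi_self_middle, Phi_self_outer]
  let t := crossTriple e a b - Phi d e a b • d
  have ht : ∀ i, ⟪F i, t⟫ = 0 := by
    have k₁ : ⟪crossTriple e n a, crossTriple e a b⟫ = 0 := by
      rw [crossTriple_swap_right, inner_neg_left, real_inner_comm,
        inner_crossTriple_of_orthonormal_pair he ha hea heb hab, hnb, neg_zero]
    have k₂ : ⟪crossTriple e n b, crossTriple e a b⟫ = 0 := by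
      rw [crossTriple_swap_right, inner_neg_left, real_inner_comm, crossTriple_swap_right e b a,
        inner_neg_left,
        inner_crossTriple_of_orthonormal_pair he hb heb hea (comm hab), hna, neg_zero, neg_zero]
    have k₃ : ⟪crossTriple e n d, crossTriple e a b⟫ = 0 := by
      rw [crossTriple_swap_right, inner_neg_left, real_inner_comm,
        inner_crossTriple_of_orthogonal he hea heb (comm hde) (comm hda) (comm hdb) hne,
        Phi_swap_right, Phi_swap_middle, h₄]
      simp
    have hg : ∀ {x : E8}, Phi x e a b = 0 → ⟪x, crossTriple e a b⟫ = 0 := fun h => by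
      rw [← Phi_eq_inner, h]
    have ha' : Phi a e a b = 0 := by rw [Phi_swap_middle, Phi_self_left, neg_zero]
    have hb' : Phi b e a b = 0 := by rw [Phi_swap_right, Phi_swap_middle, Phi_self_left]; simp
    intro i
    fin_cases i <;>
      simp [-inner_self_eq_norm_sq_to_K, F, t, inner_sub_right, real_inner_smul_right,
        (Phi_eq_inner d e a b).symm, hg, hq', k₁, k₂, k₃, hnd, hd, h₁, Phi_self_left, comm hde,
        comm hda, comm hdb, h₂, h₃, Phi_self_outer, ha', hb']
  have ht₀ : t = 0 := by
    rw [← inner_self_eq_zero (𝕜 := ℝ)]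
    refine inner_eq_zero_of_mem_span ht ?_
    rw [hF.linearIndependent.span_eq_top_of_card_eq_finrank (by simp)]
    trivial
  have hc : crossTriple e a b = Phi d e a b • d := sub_eq_zero.mp ht₀
  have := inner_crossTriple_of_orthonormal_pair he ha hea heb hab b
  rw [hb, hc, real_inner_smul_left, real_inner_smul_right, hd] at this
  linarith

/-- If an orthonormal frame in `W` has `Φ₀ = ±1`, its first vector is orthogonal to every vector
annihilating `Φ₀` on `W`. -/
theorem inner_eq_zero_of_sq_eq_one {n a b c d : E8} (ha : ⟪a, a⟫ = 1) (hb : ⟪b, b⟫ = 1)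
    (hc : ⟪c, c⟫ = 1) (hd : ⟪d, d⟫ = 1) (hbc : ⟪b, c⟫ = 0) (hbd : ⟪b, d⟫ = 0) (hcd : ⟪c, d⟫ = 0)
    (h : Phi a b c d ^ 2 = 1) (hn : Phi n b c d = 0) : ⟪a, n⟫ = 0 := by
  rw [Phi_eq_inner, crossTriple_eq_smul_of_sq_eq_one ha hb hc hd hbc hbd hcd h,
    real_inner_smul_right] at hn
  rw [real_inner_comm]
  refine (mul_eq_zero.mp hn).resolve_left fun h₀ => ?_
  rw [h₀] at h
  norm_num at h

theorem Phi0_eq_Phi (v : Fin 4 → E8) : Phi0 v = Phi (v 0) (v 1) (v 2) (v 3) := by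
  rw [Phi]
  congr 1
  ext i : 1
  fin_cases i <;> rfl

theorem span_range_eq_of_orthonormal {V : Submodule ℝ E8} {v : Fin 4 → E8}
    (hV : Module.finrank ℝ V = 4) (hmem : ∀ i, v i ∈ V) (hv : Orthonormal ℝ v) :
    Submodule.span ℝ (Set.range v) = V := by
  apply Submodule.eq_of_le_of_finrank_eq
  · exact Submodule.span_le.mpr (Set.range_subset_iff.mpr hmem)
  · rw [finrank_span_eq_card hv.linearIndependent, hV, Fintype.card_fin]

theorem exists_orthonormal_Phi0_eq_one {V : Submodule ℝ E8} {v : Fin 4 → E8}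
    (hmem : ∀ i, v i ∈ V) (hv : Orthonormal ℝ v) (h : Phi0 v ^ 2 = 1) :
    ∃ u : Fin 4 → E8, (∀ i, u i ∈ V) ∧ Orthonormal ℝ u ∧ Phi0 u = 1 := by
  rcases sq_eq_one_iff.mp h with h | h
  · exact ⟨v, hmem, hv, h⟩
  · refine ⟨v ∘ Equiv.swap 0 1, fun i => hmem _, hv.comp _ (Equiv.injective _), ?_⟩
    rw [Phi0_eq_Phi] at h ⊢
    change Phi (v 1) (v 0) (v 2) (v 3) = 1
    rw [Phi_swap_left, h, neg_neg]

/-- Every 5-dimensional subspace of `ℝ⁸` contains exactly one Cayley subspace. -/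
theorem unique_cayley_in_five_dim (W : Submodule ℝ E8)
    (hW : Module.finrank ℝ W = 5) :
    ∃! V : Submodule ℝ E8, V ≤ W ∧ IsCayley V := by
  obtain ⟨n, hnW, hn, hnPhi⟩ := exists_unit_Phi_eq_zero hW
  have hn₀ : n ≠ 0 := by rintro rfl; simp at hn
  have hle : ℝ ∙ n ≤ W := (Submodule.span_singleton_le_iff_mem n W).mpr hnW
  have hdim : Module.finrank ℝ ((ℝ ∙ n)ᗮ ⊓ W : Submodule ℝ E8) = 4 := by
    have := Submodule.finrank_add_inf_finrank_orthogonal hle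
    rw [finrank_span_singleton hn₀, hW] at this
    omega
  refine ⟨(ℝ ∙ n)ᗮ ⊓ W, ⟨inf_le_right, hdim, ?_⟩, ?_⟩
  · let B := (stdOrthonormalBasis ℝ ((ℝ ∙ n)ᗮ ⊓ W : Submodule ℝ E8)).reindex (finCongr hdim)
    let v : Fin 4 → E8 := fun i => B i
    have hv : Orthonormal ℝ v := B.orthonormal.comp_linearIsometry (Submodule.subtypeₗᵢ _)
    have hmem : ∀ i, v i ∈ ((ℝ ∙ n)ᗮ ⊓ W : Submodule ℝ E8) := fun i => (B i).2
    have hvW : ∀ i, v i ∈ W := fun i => (hmem i).2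
    have hnv : ∀ i, ⟪n, v i⟫ = 0 := fun i =>
      Submodule.mem_orthogonal_singleton_iff_inner_right.mp (hmem i).1
    have hself := fun i => (orthonormal_iff_ite.mp hv i i).trans (if_pos rfl)
    have hne : ∀ {i j}, i ≠ j → ⟪v i, v j⟫ = 0 := fun h => hv.inner_eq_zero h
    have hP : ∀ i j k, Phi n (v i) (v j) (v k) = 0 := fun i j k =>
      hnPhi _ (hvW i) _ (hvW j) _ (hvW k)
    refine exists_orthonormal_Phi0_eq_one hmem hv ?_
    rw [Phi0_eq_Phi]
    exact Phi_sq_eq_one hn (hself 0) (hself 1) (hself 2) (hself 3) (hnv 0) (hnv 1) (hnv 2) (hnv 3)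
      (hne (by decide)) (hne (by decide)) (hne (by decide)) (hne (by decide)) (hne (by decide))
      (hne (by decide)) (hP _ _ _) (hP _ _ _) (hP _ _ _) (hP _ _ _)
  · rintro V ⟨hVW, hV, v, hmem, hv, h⟩
    have hself := fun i => (orthonormal_iff_ite.mp hv i i).trans (if_pos rfl)
    have hne : ∀ {i j}, i ≠ j → ⟪v i, v j⟫ = 0 := fun h => hv.inner_eq_zero h
    have hP : ∀ i j k, Phi n (v i) (v j) (v k) = 0 := fun i j k =>
      hnPhi _ (hVW (hmem i)) _ (hVW (hmem j)) _ (hVW (hmem k))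
    rw [Phi0_eq_Phi] at h
    have key : ∀ {i j k l}, j ≠ k → j ≠ l → k ≠ l → Phi (v i) (v j) (v k) (v l) ^ 2 = 1 →
        ⟪v i, n⟫ = 0 := fun hjk hjl hkl h =>
      inner_eq_zero_of_sq_eq_one (hself _) (hself _) (hself _) (hself _) (hne hjk) (hne hjl)
        (hne hkl) h (hP _ _ _)
    have hvn : ∀ i, ⟪v i, n⟫ = 0 := by
      intro i
      fin_cases i
      · exact key (j := 1) (k := 2) (l := 3) (by decide) (by decide) (by decide) (by simp [h])
      · exact key (j := 0) (k := 2) (l := 3) (by decide) (by decide) (by decide)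
          (by simp [Phi_swap_left (v 0) (v 1), h])
      · exact key (j := 0) (k := 1) (l := 3) (by decide) (by decide) (by decide)
          (by simp [Phi_swap_left (v 0) (v 2), Phi_swap_middle _ (v 1) (v 2), h])
      · exact key (j := 0) (k := 1) (l := 2) (by decide) (by decide) (by decide)
          (by simp [Phi_swap_left (v 0) (v 3), Phi_swap_middle _ (v 1) (v 3),
            Phi_swap_right _ _ (v 2) (v 3), h])
    apply Submodule.eq_of_le_of_finrank_eq _ (hV.trans hdim.symm)
    refine le_inf (fun x hx => ?_) hVW
    rw [← span_range_eq_of_orthonormal hV hmem hv] at hx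
    exact Submodule.mem_orthogonal_singleton_iff_inner_left.mpr (inner_eq_zero_of_mem_span hvn hx)

end
end

section
/- Let W ⊆ ℝ⁸ be a 5-dimensional subspace, let (f₁,…,f₅) be an orthonormal basis of W, and let n ∈ W be the unique vector such that for all w₁, w₂, w₃, w₄ ∈ W, Φ₀(w₁,w₂,w₃,w₄) equals the determinant of the 5×5 matrix whose columns are the coordinate vectors of n, w₁, w₂, w₃, w₄ with respect to (f₁,…,f₅) (so n represents the Hodge dual ∗_W(Φ₀|_W) of the restriction of the Cayley form to W). Let X ⊆ ℝ⁸ be a Cayley subspace, let B ⊆ X ∩ W be a 3-dimensional subspace, and let u ∈ X be a unit vector orthogonal to B. Then u is orthogonal to W if and only if n ∈ B. (This is the pointwise linear-algebra core of the lemma that a Cayley submanifold with boundary in an oriented 5-dimensional scaffold W meets W orthogonally if and only if the vector field (∗_W(Φ|_W))^♯ is tangent to the boundary.) -/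
open scoped RealInnerProductSpace

noncomputable section

lemma dx4_eq (j k l m : Fin 8) (a b c d : E8) : dx4 j k l m ![a, b, c, d] =
    a j * (b k * (c l * d m - c m * d l) - b l * (c k * d m - c m * d k)
        + b m * (c k * d l - c l * d k))
      - a k * (b j * (c l * d m - c m * d l) - b l * (c j * d m - c m * d j)
        + b m * (c j * d l - c l * d j))
      + a l * (b j * (c k * d m - c m * d k) - b k * (c j * d m - c m * d j)
        + b m * (c j * d k - c k * d j))
      - a m * (b j * (c k * d l - c l * d k) - b k * (c j * d l - c l * d j)
        + b l * (c j * d k - c k * d j)) := by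
  simp [dx4, Matrix.det_succ_row_zero, Fin.sum_univ_succ, Fin.succAbove]
  ring

set_option maxHeartbeats 0 in
/-- The squared length of a triple cross product is the Gram determinant of its factors. -/
lemma sum_Phi_stdB_sq (b c d : E8) : ∑ i, Phi (stdB i) b c d ^ 2 =
    Matrix.det !![∑ i, b i * b i, ∑ i, b i * c i, ∑ i, b i * d i;
      ∑ i, b i * c i, ∑ i, c i * c i, ∑ i, c i * d i;
      ∑ i, b i * d i, ∑ i, c i * d i, ∑ i, d i * d i] := by
  have h (i j : Fin 8) : stdB i j = if j = i then 1 else 0 := by simp [stdB]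
  simp only [Phi, Phi0, dx4_eq, h, Fin.sum_univ_eight, Matrix.det_fin_three, Fin.reduceEq,
    if_true, if_false]
  simp
  ring

/-- The form `dx_{ijkl}` as an alternating map. -/
def dx4Alt (i j k l : Fin 8) : E8 [⋀^Fin 4]→ₗ[ℝ] ℝ :=
  (Matrix.detRowAlternating (n := Fin 4) (R := ℝ)).compLinearMap
    (LinearMap.pi fun r => (EuclideanSpace.proj (𝕜 := ℝ) (![i, j, k, l] r)).toLinearMap)

lemma dx4Alt_apply (i j k l : Fin 8) (v : Fin 4 → E8) : dx4Alt i j k l v = dx4 i j k l v := by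
  rw [dx4, ← Matrix.det_transpose]
  rfl

/-- The Cayley form as an alternating map. -/
def cayleyForm : E8 [⋀^Fin 4]→ₗ[ℝ] ℝ :=
  dx4Alt 0 1 2 3 + dx4Alt 0 1 4 5 - dx4Alt 0 1 6 7 + dx4Alt 0 2 4 6 + dx4Alt 0 2 5 7
    + dx4Alt 0 3 4 7 - dx4Alt 0 3 5 6 - dx4Alt 1 2 4 7 + dx4Alt 1 2 5 6 + dx4Alt 1 3 4 6
    + dx4Alt 1 3 5 7 - dx4Alt 2 3 4 5 + dx4Alt 2 3 6 7 + dx4Alt 4 5 6 7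

lemma cayleyForm_apply (v : Fin 4 → E8) : cayleyForm v = Phi0 v := by
  simp [cayleyForm, Phi0, dx4Alt_apply]

lemma inner_crossTriple (x b c d : E8) : ⟪x, crossTriple b c d⟫ = Phi x b c d := by
  let L : E8 →ₗ[ℝ] ℝ := cayleyForm.toMultilinearMap.toLinearMap ![0, b, c, d] 0
  have hL (y : E8) : L y = Phi y b c d := by
    simp only [L, MultilinearMap.toLinearMap_apply, AlternatingMap.coe_multilinearMap,
      cayleyForm_apply, Phi]
    congr 1
    funext i
    fin_cases i <;> rfl
  have hx : x = ∑ i, x i • stdB i := by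
    ext j
    simp [stdB, Pi.single_apply]
  rw [← hL x]
  conv_rhs => rw [hx, map_sum]
  simp only [map_smul, smul_eq_mul]
  simp [hL, crossTriple, PiLp.inner_apply, mul_comm]

lemma norm_crossTriple_of_orthonormal {b : Fin 3 → E8} (hb : Orthonormal ℝ b) :
    ‖crossTriple (b 0) (b 1) (b 2)‖ = 1 := by
  have hin (i j : Fin 3) : ∑ k, b i k * b j k = if i = j then 1 else 0 := by
    rw [← orthonormal_iff_ite.mp hb i j]
    simp [PiLp.inner_apply, mul_comm]
  have h := sum_Phi_stdB_sq (b 0) (b 1) (b 2)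
  simp only [hin, Matrix.det_fin_three] at h
  simp at h
  rw [EuclideanSpace.norm_eq]
  simpa [crossTriple] using h

/-- Up to sign, the Cayley form takes the same value on all orthonormal bases of a
four-dimensional subspace. -/
lemma Phi0_eq_or_eq_neg_of_orthonormal {X : Submodule ℝ E8} (hX : Module.finrank ℝ X = 4)
    {v w : Fin 4 → E8} (hv : Orthonormal ℝ v) (hvX : ∀ i, v i ∈ X)
    (hw : Orthonormal ℝ w) (hwX : ∀ i, w i ∈ X) : Phi0 w = Phi0 v ∨ Phi0 w = -Phi0 v := by
  have key {z : Fin 4 → E8} (hz : Orthonormal ℝ z) (hzX : ∀ i, z i ∈ X) :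
      ∃ e : OrthonormalBasis (Fin 4) ℝ X, ∀ i, (e i : E8) = z i := by
    have hz' : Orthonormal ℝ fun i => (⟨z i, hzX i⟩ : X) :=
      hz.codRestrict X hzX
    refine ⟨.mk hz' (hz'.linearIndependent.span_eq_top_of_card_eq_finrank' (by simp [hX])).ge, ?_⟩
    simp
  obtain ⟨e, he⟩ := key hv hvX
  obtain ⟨e', he'⟩ := key hw hwX
  have h := congrArg (fun g => g e')
    ((cayleyForm.compLinearMap X.subtype).eq_smul_basis_det e.toBasis)
  simp only [AlternatingMap.compLinearMap_apply, cayleyForm_apply, AlternatingMap.smul_apply,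
    OrthonormalBasis.coe_toBasis, Submodule.subtype_apply, he, he', smul_eq_mul] at h
  rcases e.det_to_matrix_orthonormalBasis_real e' with h1 | h1 <;> rw [h1] at h
  · left; simpa using h
  · right; simpa using h

/-- First cousin principle: contracting the Cayley form with an orthonormal triple in a Cayley
subspace gives, up to sign, the inner product with the remaining unit normal. -/
lemma IsCayley.Phi_eq_inner {X : Submodule ℝ E8} (hX : IsCayley X) {u : E8} {b : Fin 3 → E8}
    (hub : Orthonormal ℝ (Fin.cons u b : Fin 4 → E8)) (huX : u ∈ X) (hbX : ∀ i, b i ∈ X) :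
    ∃ ε : ℝ, ε ≠ 0 ∧ ∀ x, Phi x (b 0) (b 1) (b 2) = ε * ⟪u, x⟫ := by
  obtain ⟨hdim, v, hvX, hv, hv1⟩ := hX
  have hcons (x : E8) : (Fin.cons x b : Fin 4 → E8) = ![x, b 0, b 1, b 2] := by
    funext i; fin_cases i <;> rfl
  have hb : Orthonormal ℝ b := hub.comp Fin.succ (Fin.succ_injective 3)
  have hu : ‖u‖ = 1 := hub.1 0
  have hε := Phi0_eq_or_eq_neg_of_orthonormal hdim hv hvX hub
    (fun i => Fin.cases huX hbX i)
  rw [hcons, ← Phi, ← inner_crossTriple, hv1] at hε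
  have hsq : ⟪u, crossTriple (b 0) (b 1) (b 2)⟫ ^ 2 = 1 := by
    rcases hε with h | h <;> rw [h] <;> norm_num
  set ε := ⟪u, crossTriple (b 0) (b 1) (b 2)⟫
  have hcross : crossTriple (b 0) (b 1) (b 2) = ε • u := by
    rw [← sub_eq_zero, ← norm_eq_zero, ← sq_eq_zero_iff, norm_sub_sq_real, norm_smul,
      norm_crossTriple_of_orthonormal hb, inner_smul_right, real_inner_comm, hu, mul_one,
      Real.norm_eq_abs, sq_abs]
    change 1 ^ 2 - 2 * (ε * ε) + ε ^ 2 = 0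
    linear_combination -hsq
  refine ⟨ε, fun h => by simp [h] at hsq, fun x => ?_⟩
  rw [← inner_crossTriple, hcross, inner_smul_right, real_inner_comm]

/-- In a five-dimensional subspace with an orthonormal family `f` of length five, the determinant
of coordinates detects linear independence. -/
lemma det_inner_ne_zero_iff {W : Submodule ℝ E8} (hW : Module.finrank ℝ W = 5)
    {f : Fin 5 → E8} (hfW : ∀ i, f i ∈ W) (hf : Orthonormal ℝ f)
    {z : Fin 5 → E8} (hz : ∀ i, z i ∈ W) :
    Matrix.det (Matrix.of fun r c : Fin 5 => (⟪f r, z c⟫ : ℝ)) ≠ 0 ↔ LinearIndependent ℝ z := by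
  have hf' : Orthonormal ℝ fun i => (⟨f i, hfW i⟩ : W) := hf.codRestrict W hfW
  let F : OrthonormalBasis (Fin 5) ℝ W :=
    .mk hf' (hf'.linearIndependent.span_eq_top_of_card_eq_finrank' (by simp [hW])).ge
  let z' : Fin 5 → W := fun i => ⟨z i, hz i⟩
  have hdet : Matrix.det (Matrix.of fun r c : Fin 5 => (⟪f r, z c⟫ : ℝ)) = F.toBasis.det z' := by
    rw [Module.Basis.det_apply]
    congr 1
    ext r c
    simp [Module.Basis.toMatrix_apply, F, z', OrthonormalBasis.repr_apply_apply]
  have hli : LinearIndependent ℝ z ↔ LinearIndependent ℝ z' :=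
    W.subtype.linearIndependent_iff (v := z') (Submodule.ker_subtype W)
  rw [hdet, hli, ← isUnit_iff_ne_zero, ← Module.Basis.is_basis_iff_det, and_iff_left_iff_imp]
  exact fun h => h.span_eq_top_of_card_eq_finrank' (by simp [hW])

/-- A Cayley subspace `X` meets a 5-dimensional subspace `W` (along a 3-dimensional
subspace `B ⊆ X ∩ W`) orthogonally if and only if the vector `n ∈ W` representing the
Hodge dual `∗_W(Φ₀|_W)` (with respect to an orthonormal basis `f` of `W`) lies in
`B`. -/
theorem cayley_meets_orthogonally_iff_dual_tangent
    (W : Submodule ℝ E8) (hWdim : Module.finrank ℝ W = 5)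
    (f : Fin 5 → E8) (hfW : ∀ i, f i ∈ W) (hfon : Orthonormal ℝ f)
    (n : E8) (hnW : n ∈ W)
    (hn : ∀ w : Fin 4 → E8, (∀ i, w i ∈ W) →
      Phi0 w = Matrix.det (Matrix.of fun r c : Fin 5 =>
        (⟪f r, (Fin.cons n w : Fin 5 → E8) c⟫ : ℝ)))
    (X : Submodule ℝ E8) (hX : IsCayley X)
    (B : Submodule ℝ E8) (hB : B ≤ X ⊓ W) (hBdim : Module.finrank ℝ B = 3)
    (u : E8) (huX : u ∈ X) (hu : ‖u‖ = 1) (huB : ∀ b ∈ B, (⟪u, b⟫ : ℝ) = 0) :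
    (∀ w ∈ W, (⟪u, w⟫ : ℝ) = 0) ↔ n ∈ B := by
  obtain ⟨b, hbspan, hb⟩ : ∃ b : Fin 3 → E8,
      Submodule.span ℝ (Set.range b) = B ∧ Orthonormal ℝ b := by
    let e := (stdOrthonormalBasis ℝ B).reindex (finCongr hBdim)
    refine ⟨fun i => e i, ?_, e.orthonormal.comp_linearIsometry B.subtypeₗᵢ⟩
    have := congrArg (Submodule.map B.subtype) e.toBasis.span_eq
    rwa [Submodule.map_span, ← Set.range_comp, Submodule.map_top, Submodule.range_subtype] at this
  have hbB (i : Fin 3) : b i ∈ B := hbspan ▸ Submodule.subset_span ⟨i, rfl⟩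
  have hub : Orthonormal ℝ (Fin.cons u b : Fin 4 → E8) := by
    refine ⟨Fin.cases hu hb.1, fun i j hij => ?_⟩
    induction i using Fin.cases <;> induction j using Fin.cases
    · exact absurd rfl hij
    · exact huB _ (hbB _)
    · exact (real_inner_comm _ _).trans (huB _ (hbB _))
    · exact hb.2 fun h => hij (congrArg Fin.succ h)
  obtain ⟨ε, hε, hPhi⟩ := hX.Phi_eq_inner hub huX fun i => (hB (hbB i)).1
  have key (w : E8) (hw : w ∈ W) : ⟪u, w⟫ ≠ 0 ↔
      LinearIndependent ℝ (Fin.cons n (Fin.cons w b) : Fin 5 → E8) := by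
    have hwb : ∀ i, (Fin.cons w b : Fin 4 → E8) i ∈ W :=
      Fin.cases hw fun i => (hB (hbB i)).2
    have hcons : (Fin.cons w b : Fin 4 → E8) = ![w, b 0, b 1, b 2] := by
      funext i; fin_cases i <;> rfl
    rw [← det_inner_ne_zero_iff hWdim hfW hfon (Fin.cases hnW hwb), ← hn _ hwb, hcons, ← Phi,
      hPhi, mul_ne_zero_iff_left hε]
  constructor
  · intro h
    by_contra hnB
    have hli : LinearIndependent ℝ (Fin.cons n b : Fin 4 → E8) :=
      linearIndependent_finCons.mpr ⟨hb.linearIndependent, hbspan ▸ hnB⟩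
    obtain ⟨w, hw, hwn⟩ :
        ∃ w ∈ W, w ∉ Submodule.span ℝ (Set.range (Fin.cons n b : Fin 4 → E8)) := by
      by_contra! hle
      have h5 := Submodule.finrank_mono (show W ≤ _ from hle)
      rw [hWdim, finrank_span_eq_card hli, Fintype.card_fin] at h5
      omega
    refine (key w hw).mpr ?_ (h w hw)
    have hswap := (linearIndependent_finCons.mpr ⟨hli, hwn⟩).comp _ (Equiv.swap 0 1).injective
    have hcomp : (Fin.cons n (Fin.cons w b) : Fin 5 → E8) =
        Fin.cons w (Fin.cons n b : Fin 4 → E8) ∘ Equiv.swap 0 1 := by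
      funext i
      fin_cases i <;> rfl
    rw [hcomp]
    exact hswap
  · intro hnB w hw
    by_contra hne
    refine (linearIndependent_finCons.mp ((key w hw).mp hne)).2 ?_
    refine Submodule.span_mono ?_ (hbspan.symm ▸ hnB)
    rw [Fin.range_cons]
    exact Set.subset_insert _ _

end
end
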